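/- arXiv:2604.02386 — 3 statements merged into one kernel-verified Lean document; each statement's English description precedes it below -/
import Mathlib

section
/- Let k ≥ 2 and a₀ be integers with 2 ≤ a₀ < k and gcd(a₀, k) = 1, and let b₀ ∈ {0,1,...,k-1}. Define sequences a⁽⁰⁾ = k, a⁽¹⁾ = a₀, a⁽ⁿ⁾ = δ_{a⁽ⁿ⁻¹⁾}(a⁽ⁿ⁻²⁾), and b⁽¹⁾ = b₀, b⁽ⁿ⁾ = a⁽ⁿ⁻¹⁾ - δ_{a⁽ⁿ⁻¹⁾}(b⁽ⁿ⁻¹⁾), and let r be the unique index with a⁽ʳ⁾ = 1. Then the rational number k·∑_{j=0}^{r-1} b⁽ʲ⁺¹⁾/(a⁽ʲ⁾·a⁽ʲ⁺¹⁾) is an integer, and x = δ_k( k·∑_{j=0}^{r-1} b⁽ʲ⁺¹⁾/(a⁽ʲ⁾·a⁽ʲ⁺¹⁾) ) is the unique solution in {0,1,...,k-1} of the equation δ_k(a₀·x) = b₀. -/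
/-- The remainder operator: `delta k x = x - k * ⌊x/k⌋`. -/
def delta (k x : ℤ) : ℤ := x - k * (x / k)

theorem delta_eq_emod (k x : ℤ) : delta k x = x % k := by
  rw [delta, Int.emod_def]

/-- Back substitution along a Euclidean sequence ending in `1`. -/
theorem exists_int_eq_sum_and_dvd (r : ℕ) : ∀ A B : ℕ → ℤ,
    A (r + 1) = 1 → (∀ n ≤ r, A n ≠ 0) →
    (∀ n, A (n + 1) ∣ A n - A (n + 2)) → (∀ n, A (n + 1) ∣ B (n + 2) + B (n + 1)) →
    ∃ z : ℤ,
      (z : ℚ) = (A 0 : ℚ) * ∑ j ∈ Finset.range (r + 1),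
          (B (j + 1) : ℚ) / ((A j : ℚ) * (A (j + 1) : ℚ)) ∧
      A 0 ∣ A 1 * z - B 1 := by
  induction r with
  | zero =>
    intro A B hA hne _ _
    have h0 : (A 0 : ℚ) ≠ 0 := by exact_mod_cast hne 0 le_rfl
    rw [zero_add] at hA
    refine ⟨B 1, ?_, by simp [hA]⟩
    simp only [zero_add, Finset.sum_range_one, hA]
    field_simp
    simp
  | succ r ih =>
    intro A B hA hne hdA hdB
    obtain ⟨y, hy, hyd⟩ := ih (fun n => A (n + 1)) (fun n => B (n + 1)) hA
      (fun n hn => hne (n + 1) (by omega)) (fun n => hdA (n + 1)) (fun n => hdB (n + 1))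
    have hd : A 1 ∣ A 0 * y + B 1 := by
      change A 1 ∣ A 2 * y - B 2 at hyd
      have h : A 0 * y + B 1 = (A 0 - A 2) * y + ((A 2 * y - B 2) + (B 2 + B 1)) := by ring
      rw [h]
      exact ((hdA 0).mul_right y).add (hyd.add (hdB 0))
    obtain ⟨z, hz⟩ := hd
    have h0 : (A 0 : ℚ) ≠ 0 := by exact_mod_cast hne 0 (by omega)
    have h1 : (A 1 : ℚ) ≠ 0 := by exact_mod_cast hne 1 (by omega)
    refine ⟨z, ?_, ⟨y, by linarith⟩⟩
    have hz' : (A 0 : ℚ) * y + B 1 = A 1 * z := by exact_mod_cast hz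
    rw [Finset.sum_range_succ', mul_add]
    simp only [zero_add] at hy ⊢
    apply mul_left_cancel₀ h1
    rw [← hz', hy]
    field_simp

theorem euclid_pos_of_lt (A : ℕ → ℤ) (h0 : 0 < A 0) (h1 : 0 < A 1)
    (hcop : Int.gcd (A 0) (A 1) = 1) (hrec : ∀ n, A (n + 2) = A n % A (n + 1))
    (r : ℕ) (hfirst : ∀ m < r, A m ≠ 1) (n : ℕ) (hn : n < r) :
    0 < A n ∧ 0 < A (n + 1) ∧ Int.gcd (A n) (A (n + 1)) = 1 := by
  induction n with
  | zero => exact ⟨h0, h1, hcop⟩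
  | succ n ih =>
    obtain ⟨_, hp, hg⟩ := ih (by omega)
    have hg' : Int.gcd (A (n + 1)) (A (n + 2)) = 1 := by
      rw [hrec, Int.gcd_comm, Int.gcd_emod, hg]
    refine ⟨hp, lt_of_le_of_ne ?_ fun h => hfirst (n + 1) hn ?_, hg'⟩
    · rw [hrec]
      exact Int.emod_nonneg _ hp.ne'
    · rw [← h, Int.gcd_zero_right] at hg'
      omega

/-- Explicit formula for the unique solution of `δ_k(a₀ x) = b₀` via the
Euclidean algorithm: the rational number `k * ∑_{j<r} b⁽ʲ⁺¹⁾/(a⁽ʲ⁾ a⁽ʲ⁺¹⁾)`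
is an integer `z`, and `δ_k(z)` is the unique solution in `{0,…,k-1}`. -/
theorem stmt7 (k a₀ b₀ : ℤ) (h1 : 2 ≤ a₀) (h2 : a₀ < k)
    (hcop : Int.gcd a₀ k = 1) (hb : 0 ≤ b₀ ∧ b₀ ≤ k - 1)
    (A B : ℕ → ℤ) (hA0 : A 0 = k) (hA1 : A 1 = a₀)
    (hArec : ∀ n : ℕ, A (n + 2) = delta (A (n + 1)) (A n))
    (hB1 : B 1 = b₀)
    (hBrec : ∀ n : ℕ, 1 ≤ n → B (n + 1) = A n - delta (A n) (B n))
    (r : ℕ) (hr : A r = 1) (hrfirst : ∀ m : ℕ, m < r → A m ≠ 1) :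
    ∃ z : ℤ,
      (z : ℚ) = (k : ℚ) * ∑ j ∈ Finset.range r,
          (B (j + 1) : ℚ) / ((A j : ℚ) * (A (j + 1) : ℚ)) ∧
      (∀ x : ℤ, (0 ≤ x ∧ x ≤ k - 1 ∧ delta k (a₀ * x) = b₀) ↔ x = delta k z) := by
  simp only [delta_eq_emod] at *
  have hpos := euclid_pos_of_lt A (by omega) (by omega)
    (by rw [hA0, hA1, Int.gcd_comm, hcop]) hArec r hrfirst
  obtain ⟨s, rfl⟩ : ∃ s, r = s + 1 := by
    refine Nat.exists_eq_succ_of_ne_zero ?_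
    rintro rfl
    omega
  obtain ⟨z, hz, hd⟩ := exists_int_eq_sum_and_dvd s A B hr
    (fun n hn => (hpos n (by omega)).1.ne')
    (fun n => by rw [hArec]; exact Int.dvd_self_sub_emod)
    (fun n => by
      rw [hBrec (n + 1) (by omega)]
      rw [sub_add_eq_add_sub, add_sub_assoc]
      exact (dvd_refl _).add Int.dvd_self_sub_emod)
  rw [hA0] at hz hd
  rw [hA1, hB1] at hd
  refine ⟨z, hz, fun x => ?_⟩
  have hb' : b₀ % k = b₀ := Int.emod_eq_of_lt hb.1 (by omega)
  constructor
  · rintro ⟨hx0, hxk, hx⟩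
    have hdx : k ∣ a₀ * x - b₀ := by
      rw [← hx]
      exact Int.dvd_self_sub_emod
    have hsub : k ∣ a₀ * (x - z) := by
      have h : a₀ * (x - z) = (a₀ * x - b₀) - (a₀ * z - b₀) := by ring
      rw [h]
      exact hdx.sub hd
    have hxz : k ∣ x - z :=
      Int.dvd_of_dvd_mul_right_of_gcd_one hsub (by rw [Int.gcd_comm, hcop])
    rw [← Int.emod_eq_emod_iff_emod_sub_eq_zero.2 (Int.emod_eq_zero_of_dvd hxz),
      Int.emod_eq_of_lt hx0 (by omega)]
  · rintro rfl
    have hk : 0 < k := by omega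
    refine ⟨Int.emod_nonneg _ hk.ne', by have := Int.emod_lt_of_pos z hk; omega, ?_⟩
    rw [Int.mul_emod, Int.emod_emod, ← Int.mul_emod, Int.emod_eq_emod_iff_emod_sub_eq_zero.2
      (Int.emod_eq_zero_of_dvd hd), hb']
end

section
/- Let p ≥ 2 be an integer and let a, r ∈ {0,1,...,p-1}. The number of pairs (s,t) with s, t ∈ {0,1,...,p-1} \ {a}, s + t = p + r, and s ≤ t equals ⌊(p - r)/2⌋ - H(a - r - 1), where H(x) = 1 if x ≥ 0 and H(x) = 0 if x < 0. -/
/-- Step function: `Hstep x = 1` if `x ≥ 0`, `0` otherwise. -/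
def Hstep (x : ℤ) : ℤ := if 0 ≤ x then 1 else 0

theorem stmt13 (p a r : ℤ) (hp : 2 ≤ p)
    (ha : 0 ≤ a ∧ a ≤ p - 1) (hr : 0 ≤ r ∧ r ≤ p - 1) :
    ((((Finset.Icc 0 (p - 1)) ×ˢ (Finset.Icc 0 (p - 1))).filter
        (fun st : ℤ × ℤ =>
          st.1 ≠ a ∧ st.2 ≠ a ∧ st.1 + st.2 = p + r ∧ st.1 ≤ st.2)).card : ℤ)
      = (p - r) / 2 - Hstep (a - r - 1) := by
  have hset : (((Finset.Icc 0 (p - 1)) ×ˢ (Finset.Icc 0 (p - 1))).filter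
        (fun st : ℤ × ℤ =>
          st.1 ≠ a ∧ st.2 ≠ a ∧ st.1 + st.2 = p + r ∧ st.1 ≤ st.2))
      = ((Finset.Icc (r + 1) ((p + r) / 2)).erase (min a (p + r - a))).image
          (fun s => (s, p + r - s)) := by
    ext ⟨s, t⟩
    simp only [Finset.mem_filter, Finset.mem_product, Finset.mem_Icc, Finset.mem_image,
      Finset.mem_erase, Prod.mk.injEq]
    constructor
    · rintro ⟨_, _, _, _, _⟩
      exact ⟨s, by omega, rfl, by omega⟩
    · rintro ⟨s', _, rfl, rfl⟩
      omega
  rw [hset, Finset.card_image_of_injective _ fun x y h => congrArg Prod.fst h]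
  unfold Hstep
  split_ifs with h
  · have hmem : min a (p + r - a) ∈ Finset.Icc (r + 1) ((p + r) / 2) := by
      rw [Finset.mem_Icc]
      omega
    rw [Finset.card_erase_of_mem hmem, Int.card_Icc]
    omega
  · have hmem : min a (p + r - a) ∉ Finset.Icc (r + 1) ((p + r) / 2) := by
      rw [Finset.mem_Icc]
      omega
    rw [Finset.erase_eq_of_notMem hmem, Int.card_Icc]
    omega
end

section
/- Let p ≥ 2 be an integer and let a, b, r ∈ {0,1,...,p-1}. The number of pairs (s,t) with s ∈ {0,1,...,p-1} \ {a}, t ∈ {0,1,...,p-1} \ {b}, and s + t = p + r equals p - r - 1 - H(a - r - 1) - H(b - r - 1) + 𝟙(a + b - p - r), where H(x) = 1 if x ≥ 0 and H(x) = 0 if x < 0, and 𝟙(x) = 1 if x = 0 and 𝟙(x) = 0 otherwise. -/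
/-- Zero indicator: `indZero x = 1` if `x = 0`, `0` otherwise. -/
def indZero (x : ℤ) : ℤ := if x = 0 then 1 else 0

theorem stmt15 (p a b r : ℤ) (hp : 2 ≤ p)
    (ha : 0 ≤ a ∧ a ≤ p - 1) (hb : 0 ≤ b ∧ b ≤ p - 1) (hr : 0 ≤ r ∧ r ≤ p - 1) :
    ((((Finset.Icc 0 (p - 1)) ×ˢ (Finset.Icc 0 (p - 1))).filter
        (fun st : ℤ × ℤ => st.1 ≠ a ∧ st.2 ≠ b ∧ st.1 + st.2 = p + r)).card : ℤ)
      = p - r - 1 - Hstep (a - r - 1) - Hstep (b - r - 1)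
          + indZero (a + b - p - r) := by
  have himage : ((Finset.Icc 0 (p - 1)) ×ˢ (Finset.Icc 0 (p - 1))).filter
        (fun st : ℤ × ℤ => st.1 ≠ a ∧ st.2 ≠ b ∧ st.1 + st.2 = p + r)
      = (((Finset.Icc (r + 1) (p - 1)).erase a).erase (p + r - b)).image
          (fun s => (s, p + r - s)) := by
    ext ⟨s, t⟩
    simp only [Finset.mem_filter, Finset.mem_product, Finset.mem_Icc, Finset.mem_image,
      Finset.mem_erase, Prod.mk.injEq]
    constructor
    · intro h
      exact ⟨s, by omega, rfl, by omega⟩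
    · rintro ⟨u, h, rfl, rfl⟩
      omega
  rw [himage, Finset.card_image_of_injective _ (fun x y h => (Prod.mk.inj h).1)]
  simp only [Finset.card_erase_eq_ite, Finset.mem_erase, Finset.mem_Icc, Int.card_Icc,
    Hstep, indZero]
  split_ifs <;> omega
end
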